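/- arXiv:2602.15252 — 2 statements merged into one kernel-verified Lean document; each statement's English description precedes it below -/
import Mathlib

section
/- Let g(x) = (3/16)²·(x − 1/4)²·(x − 3/4)² and consider the utility U(p,q) = g(p) on the simplex Δ² = {(p,q) : p,q ≥ 0, p + q = 1}, so that the gradient at (p,q) is u(p,q) = (g′(p), 0). Run regret matching (RM) from any initialization x^{(1)} = (p₁, 1 − p₁) with p₁ ∉ {1/4, 1/2, 3/4}. Then for every t ≥ 2, the iterate x^{(t)} is a vertex of Δ², namely x^{(t)} = (1,0) for all t ≥ 2 if g′(p₁) > 0 or p₁ = 1, and x^{(t)} = (0,1) for all t ≥ 2 if g′(p₁) < 0 or p₁ = 0; in either case U(x^{(t)}) = 81/65536, the global maximum of U over Δ². -/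
/-- The iterate of regret matching obtained from the regret vector `ρ` and the previous
iterate `y`. -/
def IsRegretMatchingStep (ρ y z : ℝ × ℝ) : Prop :=
  ((max ρ.1 0, max ρ.2 0) ≠ ((0 : ℝ), (0 : ℝ)) →
    z = (max ρ.1 0 / (max ρ.1 0 + max ρ.2 0), max ρ.2 0 / (max ρ.1 0 + max ρ.2 0))) ∧
  ((max ρ.1 0, max ρ.2 0) = ((0 : ℝ), (0 : ℝ)) → z = y)

lemma IsRegretMatchingStep.eq_fst_vertex {ρ y z : ℝ × ℝ} (h : IsRegretMatchingStep ρ y z)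
    (h₁ : 0 ≤ ρ.1) (h₂ : ρ.2 ≤ 0) (hy : 0 < ρ.1 ∨ y = (1, 0)) : z = (1, 0) := by
  obtain ⟨hpos, hzero⟩ := h
  rw [max_eq_left h₁, max_eq_right h₂] at hpos hzero
  rcases h₁.eq_or_lt with h0 | h0
  · rw [hzero (by rw [← h0])]
    exact hy.resolve_left (by rw [← h0]; exact lt_irrefl _)
  · simpa [h0.ne'] using hpos (by simp [h0.ne'])

lemma IsRegretMatchingStep.eq_snd_vertex {ρ y z : ℝ × ℝ} (h : IsRegretMatchingStep ρ y z)
    (h₁ : ρ.1 ≤ 0) (h₂ : 0 ≤ ρ.2) (hy : 0 < ρ.2 ∨ y = (0, 1)) : z = (0, 1) := by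
  obtain ⟨hpos, hzero⟩ := h
  rw [max_eq_left h₂, max_eq_right h₁] at hpos hzero
  rcases h₂.eq_or_lt with h0 | h0
  · rw [hzero (by rw [← h0])]
    exact hy.resolve_left (by rw [← h0]; exact lt_irrefl _)
  · simpa [h0.ne'] using hpos (by simp [h0.ne'])

lemma hasDerivAt_quartic (y : ℝ) :
    HasDerivAt (fun y : ℝ => (3 / 16) ^ 2 * (y - 1 / 4) ^ 2 * (y - 3 / 4) ^ 2)
      (9 / 64 * ((y - 1 / 4) * (y - 1 / 2) * (y - 3 / 4))) y := by
  have h (a : ℝ) : HasDerivAt (fun y : ℝ => (y - a) ^ 2) (2 * (y - a)) y := by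
    exact (((hasDerivAt_id y).sub_const a).fun_pow 2).congr_deriv (by simp)
  refine (((h (1 / 4)).const_mul ((3 / 16) ^ 2)).mul (h (3 / 4))).congr_deriv ?_
  ring

lemma quartic_le {y : ℝ} (h0 : 0 ≤ y) (h1 : y ≤ 1) :
    (3 / 16) ^ 2 * (y - 1 / 4) ^ 2 * (y - 3 / 4) ^ 2 ≤ 81 / 65536 := by
  have hlo : -(3 / 16) ≤ (y - 1 / 4) * (y - 3 / 4) := by nlinarith [sq_nonneg (y - 1 / 2)]
  have hhi : (y - 1 / 4) * (y - 3 / 4) ≤ 3 / 16 := by nlinarith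
  have := sq_le_sq' hlo hhi
  linarith


/-- Regret matching on the 2-simplex for `U(p,q) = g(p)` with
`g(x) = (3/16)²·(x − 1/4)²·(x − 3/4)²` and gradient `u(p,q) = (g'(p), 0)`:
from any initialization `x^{(1)} = (p₁, 1 − p₁)` with `p₁ ∉ {1/4, 1/2, 3/4}`,
every iterate `x^{(t)}` with `t ≥ 2` is a vertex of the simplex — namely `(1,0)`
if `g'(p₁) > 0` or `p₁ = 1`, and `(0,1)` if `g'(p₁) < 0` or `p₁ = 0` — and in
either case `U(x^{(t)}) = g((x^{(t)})₁) = 81/65536`, the global maximum of `U`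
over the simplex. -/
theorem stmt11 (g : ℝ → ℝ)
    (hg : ∀ y : ℝ, g y = (3 / 16) ^ 2 * (y - 1 / 4) ^ 2 * (y - 3 / 4) ^ 2)
    (p₁ : ℝ) (hp₁0 : 0 ≤ p₁) (hp₁1 : p₁ ≤ 1)
    (hp₁ : p₁ ≠ 1 / 4 ∧ p₁ ≠ 1 / 2 ∧ p₁ ≠ 3 / 4)
    (r x u : ℕ → ℝ × ℝ)
    (hu : ∀ t : ℕ, u t = (deriv g (x t).1, 0))
    (hr1 : r 1 = (0, 0)) (hx1 : x 1 = (p₁, 1 - p₁))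
    (hr : ∀ t : ℕ, 1 ≤ t → r (t + 1) =
      ((r t).1 + (u t).1 - ((u t).1 * (x t).1 + (u t).2 * (x t).2),
       (r t).2 + (u t).2 - ((u t).1 * (x t).1 + (u t).2 * (x t).2)))
    (hxpos : ∀ t : ℕ, 2 ≤ t → (max (r t).1 0, max (r t).2 0) ≠ ((0 : ℝ), (0 : ℝ)) →
      x t = (max (r t).1 0 / (max (r t).1 0 + max (r t).2 0),
             max (r t).2 0 / (max (r t).1 0 + max (r t).2 0)))
    (hxzero : ∀ t : ℕ, 2 ≤ t → (max (r t).1 0, max (r t).2 0) = ((0 : ℝ), (0 : ℝ)) →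
      x t = x (t - 1)) :
    ∀ t : ℕ, 2 ≤ t →
      (x t = (1, 0) ∨ x t = (0, 1)) ∧
      ((0 < deriv g p₁ ∨ p₁ = 1) → x t = (1, 0)) ∧
      ((deriv g p₁ < 0 ∨ p₁ = 0) → x t = (0, 1)) ∧
      g (x t).1 = 81 / 65536 ∧
      IsGreatest ((fun q : ℝ × ℝ => g q.1) ''
        {q : ℝ × ℝ | 0 ≤ q.1 ∧ 0 ≤ q.2 ∧ q.1 + q.2 = 1}) (81 / 65536) := by
  have hderiv (y : ℝ) : deriv g y = 9 / 64 * ((y - 1 / 4) * (y - 1 / 2) * (y - 3 / 4)) := by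
    rw [funext hg]
    exact (hasDerivAt_quartic y).deriv
  have hd0 : deriv g 0 < 0 := by rw [hderiv]; norm_num
  have hd1 : 0 < deriv g 1 := by rw [hderiv]; norm_num
  have hg0 : g 0 = 81 / 65536 := by rw [hg]; norm_num
  have hg1 : g 1 = 81 / 65536 := by rw [hg]; norm_num
  have hne : deriv g p₁ ≠ 0 := by
    obtain ⟨ha, hb, hc⟩ := hp₁
    rw [hderiv]
    simp only [ne_eq, mul_eq_zero, sub_eq_zero, ha, hb, hc, or_self, or_false]
    norm_num
  have hmax : IsGreatest ((fun q : ℝ × ℝ => g q.1) ''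
      {q : ℝ × ℝ | 0 ≤ q.1 ∧ 0 ≤ q.2 ∧ q.1 + q.2 = 1}) (81 / 65536) := by
    refine ⟨⟨(1, 0), by norm_num, hg1⟩, ?_⟩
    rintro _ ⟨q, ⟨h1, h2, h3⟩, rfl⟩
    simp only [hg]
    exact quartic_le h1 (by linarith)
  have hstep (t : ℕ) (ht : 1 ≤ t) : IsRegretMatchingStep (r (t + 1)) (x t) (x (t + 1)) :=
    ⟨hxpos _ (by omega), hxzero _ (by omega)⟩
  have hreg (t : ℕ) (ht : 1 ≤ t) : r (t + 1) =
      ((r t).1 + deriv g (x t).1 * (1 - (x t).1), (r t).2 - deriv g (x t).1 * (x t).1) := by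
    rw [hr t ht, hu t]
    ext <;> simp only <;> ring
  have hr2 : r 2 = (deriv g p₁ * (1 - p₁), -(deriv g p₁ * p₁)) := by
    rw [hreg 1 le_rfl, hr1, hx1]
    simp
  rcases lt_or_gt_of_ne hne with hneg | hpos
  · have hp1 : p₁ < 1 := hp₁1.lt_of_ne (by rintro rfl; exact hneg.not_gt hd1)
    have key (t : ℕ) (ht : 2 ≤ t) : x t = (0, 1) ∧ (r t).1 ≤ 0 ∧ 0 ≤ (r t).2 := by
      induction t, ht using Nat.le_induction with
      | base =>
        have h1 : (r 2).1 ≤ 0 := by rw [hr2]; simp only; nlinarith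
        have h2 : 0 ≤ (r 2).2 := by rw [hr2]; simp only; nlinarith
        refine ⟨(hstep 1 le_rfl).eq_snd_vertex h1 h2 ?_, h1, h2⟩
        rcases hp₁0.eq_or_lt with rfl | h
        · right; rw [hx1]; simp
        · left; rw [hr2]; simp only; nlinarith
      | succ t ht ih =>
        obtain ⟨hx, h1, h2⟩ := ih
        have hr' := hreg t (by omega)
        have h1' : (r (t + 1)).1 ≤ 0 := by rw [hr', hx]; simp only; linarith
        have h2' : 0 ≤ (r (t + 1)).2 := by rw [hr', hx]; simp only; linarith
        exact ⟨(hstep t (by omega)).eq_snd_vertex h1' h2' (.inr hx), h1', h2'⟩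
    intro t ht
    have hx := (key t ht).1
    refine ⟨.inr hx, fun h => ?_, fun _ => hx, by rw [hx, hg0], hmax⟩
    rcases h with h | h
    · exact absurd h hneg.not_gt
    · exact absurd h hp1.ne
  · have hp0 : 0 < p₁ := hp₁0.lt_of_ne (by rintro rfl; exact hpos.not_gt hd0)
    have key (t : ℕ) (ht : 2 ≤ t) : x t = (1, 0) ∧ 0 ≤ (r t).1 ∧ (r t).2 ≤ 0 := by
      induction t, ht using Nat.le_induction with
      | base =>
        have h1 : 0 ≤ (r 2).1 := by rw [hr2]; simp only; nlinarith
        have h2 : (r 2).2 ≤ 0 := by rw [hr2]; simp only; nlinarith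
        refine ⟨(hstep 1 le_rfl).eq_fst_vertex h1 h2 ?_, h1, h2⟩
        rcases hp₁1.eq_or_lt with rfl | h
        · right; rw [hx1]; simp
        · left; rw [hr2]; simp only; nlinarith
      | succ t ht ih =>
        obtain ⟨hx, h1, h2⟩ := ih
        have hr' := hreg t (by omega)
        have h1' : 0 ≤ (r (t + 1)).1 := by rw [hr', hx]; simp only; linarith
        have h2' : (r (t + 1)).2 ≤ 0 := by rw [hr', hx]; simp only; linarith
        exact ⟨(hstep t (by omega)).eq_fst_vertex h1' h2' (.inr hx), h1', h2'⟩
    intro t ht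
    have hx := (key t ht).1
    refine ⟨.inl hx, fun _ => hx, fun h => ?_, by rw [hx, hg1], hmax⟩
    rcases h with h | h
    · exact absurd h hpos.not_gt
    · exact absurd h hp0.ne'
end

section
/- Consider the utility U(p,q) = 16·p²·q² on the simplex Δ² = {(p,q) : p,q ≥ 0, p + q = 1}, with gradient u(p,q) = (32·p·q², 32·p²·q). Run regret matching (RM) from any initialization x^{(1)} = (p₁, 1 − p₁) with p₁ ≠ 1/2. Then for every t ≥ 2 the iterate x^{(t)} lies in {(1,0), (0,1)} and hence U(x^{(t)}) = 0, the global minimum of U over Δ², even though the global maximum of U over Δ² equals 1 (attained at (1/2, 1/2)). -/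
/-- If at most one coordinate of `a` is positive and one of them is, then normalizing the
positive part of `a` yields a vertex of the simplex. -/
theorem normalized_posPart_eq_vertex {a : ℝ × ℝ} (hnot : ¬(0 < a.1 ∧ 0 < a.2))
    (hpos : (max a.1 0, max a.2 0) ≠ ((0 : ℝ), (0 : ℝ))) :
    (max a.1 0 / (max a.1 0 + max a.2 0), max a.2 0 / (max a.1 0 + max a.2 0)) =
        ((1 : ℝ), (0 : ℝ)) ∨
      (max a.1 0 / (max a.1 0 + max a.2 0), max a.2 0 / (max a.1 0 + max a.2 0)) =
        ((0 : ℝ), (1 : ℝ)) := by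
  rcases le_or_gt a.1 0 with h1 | h1 <;> rcases le_or_gt a.2 0 with h2 | h2
  · simp [h1, h2] at hpos
  · right
    simp [h1, h2.le, h2.ne']
  · left
    simp [h1.le, h2, h1.ne']
  · exact absurd ⟨h1, h2⟩ hnot

/-- Regret matching on the 2-simplex for `U(p,q) = 16·p²·q²`, with gradient
`u(p,q) = (32·p·q², 32·p²·q)`: from any initialization `x^{(1)} = (p₁, 1 − p₁)` with
`p₁ ≠ 1/2`, every iterate `x^{(t)}` with `t ≥ 2` lies in `{(1,0), (0,1)}`, hence
`U(x^{(t)}) = 0`, the global minimum of `U` over the simplex, even though the global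
maximum of `U` over the simplex equals `1`, attained at `(1/2, 1/2)`. -/
theorem stmt13 (p₁ : ℝ) (hp₁0 : 0 ≤ p₁) (hp₁1 : p₁ ≤ 1) (hp₁ : p₁ ≠ 1 / 2)
    (r x u : ℕ → ℝ × ℝ)
    (hu : ∀ t : ℕ, u t = (32 * (x t).1 * (x t).2 ^ 2, 32 * (x t).1 ^ 2 * (x t).2))
    (hr1 : r 1 = (0, 0)) (hx1 : x 1 = (p₁, 1 - p₁))
    (hr : ∀ t : ℕ, 1 ≤ t → r (t + 1) =
      ((r t).1 + (u t).1 - ((u t).1 * (x t).1 + (u t).2 * (x t).2),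
       (r t).2 + (u t).2 - ((u t).1 * (x t).1 + (u t).2 * (x t).2)))
    (hxpos : ∀ t : ℕ, 2 ≤ t → (max (r t).1 0, max (r t).2 0) ≠ ((0 : ℝ), (0 : ℝ)) →
      x t = (max (r t).1 0 / (max (r t).1 0 + max (r t).2 0),
             max (r t).2 0 / (max (r t).1 0 + max (r t).2 0)))
    (hxzero : ∀ t : ℕ, 2 ≤ t → (max (r t).1 0, max (r t).2 0) = ((0 : ℝ), (0 : ℝ)) →
      x t = x (t - 1)) :
    (∀ t : ℕ, 2 ≤ t →
      (x t = (1, 0) ∨ x t = (0, 1)) ∧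
      16 * (x t).1 ^ 2 * (x t).2 ^ 2 = 0) ∧
    (∀ p q : ℝ, 0 ≤ p → 0 ≤ q → p + q = 1 →
      0 ≤ 16 * p ^ 2 * q ^ 2 ∧ 16 * p ^ 2 * q ^ 2 ≤ 1) ∧
    16 * ((1 : ℝ) / 2) ^ 2 * ((1 : ℝ) / 2) ^ 2 = 1 := by
  refine ⟨?_, ?_, by norm_num⟩
  · have hr2 : r 2 = (32 * p₁ * (1 - p₁) ^ 2 * (1 - 2 * p₁),
        -(32 * p₁ ^ 2 * (1 - p₁) * (1 - 2 * p₁))) := by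
      rw [hr 1 le_rfl, hu 1, hr1, hx1]
      ext <;> ring
    have hvertex : ∀ t, 2 ≤ t → ¬(0 < (r t).1 ∧ 0 < (r t).2) →
        ((max (r t).1 0, max (r t).2 0) = ((0 : ℝ), (0 : ℝ)) →
          x (t - 1) = (1, 0) ∨ x (t - 1) = (0, 1)) →
        x t = (1, 0) ∨ x t = (0, 1) := by
      intro t ht hnot hprev
      by_cases hz : (max (r t).1 0, max (r t).2 0) = ((0 : ℝ), (0 : ℝ))
      · rw [hxzero t ht hz]
        exact hprev hz
      · rw [hxpos t ht hz]
        exact normalized_posPart_eq_vertex hnot hz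
    have hinv : ∀ t, 2 ≤ t →
        (x t = (1, 0) ∨ x t = (0, 1)) ∧ ¬(0 < (r t).1 ∧ 0 < (r t).2) := by
      intro t ht
      induction t, ht using Nat.le_induction with
      | base =>
        have hq : 0 ≤ 1 - p₁ := by linarith
        have hnot : ¬(0 < (r 2).1 ∧ 0 < (r 2).2) := by
          rw [hr2]
          rintro ⟨h1, h2⟩
          rcases le_total 0 (1 - 2 * p₁) with h | h
          · have : 0 ≤ 32 * p₁ ^ 2 * (1 - p₁) * (1 - 2 * p₁) := by positivity
            linarith
          · exact h1.not_ge (mul_nonpos_of_nonneg_of_nonpos (by positivity) h)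
        refine ⟨hvertex 2 le_rfl hnot fun hz => ?_, hnot⟩
        change x 1 = (1, 0) ∨ x 1 = (0, 1)
        rw [hx1]
        rcases hp₁0.eq_or_lt with h0 | h0
        · right
          simp [← h0]
        rcases hp₁1.eq_or_lt with h1 | h1
        · left
          simp [h1]
        exfalso
        rw [hr2, Prod.mk.injEq, max_eq_right_iff, max_eq_right_iff] at hz
        obtain ⟨hz1, hz2⟩ := hz
        have hq' : 0 < 1 - p₁ := by linarith
        have hle : 1 - 2 * p₁ ≤ 0 := nonpos_of_mul_nonpos_right hz1 (by positivity)
        have hge : 0 ≤ 1 - 2 * p₁ :=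
          nonneg_of_mul_nonneg_right (neg_nonpos.mp hz2) (by positivity)
        exact hp₁ (by linarith)
      | succ t ht ih =>
        have hconst : r (t + 1) = r t := by
          rw [hr t (by omega), hu t]
          rcases ih.1 with h | h <;> simp [h]
        have hnot : ¬(0 < (r (t + 1)).1 ∧ 0 < (r (t + 1)).2) := hconst ▸ ih.2
        exact ⟨hvertex (t + 1) (by omega) hnot fun _ => ih.1, hnot⟩
    intro t ht
    have h := (hinv t ht).1
    refine ⟨h, ?_⟩
    rcases h with h | h <;> simp [h]
  · intro p q hp hq hpq
    have h4 : 4 * (p * q) ≤ 1 := by nlinarith [sq_nonneg (p - q)]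
    have hpq0 : 0 ≤ p * q := mul_nonneg hp hq
    exact ⟨by positivity, by nlinarith⟩
end
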